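/- The topological space c₀ \ ⋃_{n=1}^∞ Eⁿ, with the subspace topology, is homeomorphic to A₂*. -/

import Mathlib

open scoped ZeroAtInfty
open Filter

noncomputable section

variable (K : Type*) [NontriviallyNormedField K] [IsUltrametricDist K] [CompleteSpace K]
  [LocallyCompactSpace K]

/-- The partial sum `x_1 + ⋯ + x_m` of the first `m` coordinates of a sequence. -/
def pSum (x : ℕ → K) (m : ℕ) : K := ∑ j ∈ Finset.range m, x j

/-- The set `A₂`: sequences `x ∈ c₀` with `sup_k |Σ_{j=1}^k x_j| = 1`,
`Σ_{j=1}^k x_j ≠ 1` for all `k ≥ 1`, and `Σ_{j=1}^∞ x_j = 1`. -/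
def A2 : Set C₀(ℕ, K) :=
  {x | (⨆ k : ℕ, ‖pSum K (⇑x) (k + 1)‖) = 1 ∧
    (∀ k : ℕ, pSum K (⇑x) (k + 1) ≠ 1) ∧
    Tendsto (fun m => pSum K (⇑x) m) atTop (nhds 1)}

/-- The union `⋃ₙ Eⁿ` of the sets `Eⁿ = {x ∈ c₀ : x_k = 0 ∀ k > n}`:
the eventually-zero sequences. -/
def evZero : Set C₀(ℕ, K) := ⋃ n : ℕ, {x | ∀ k, n ≤ k → x k = 0}

/-- `A₂* = A₂ \ ⋃ₙ Eⁿ`. -/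
def A2star : Set C₀(ℕ, K) := A2 K \ evZero K

open Topology Set TopologicalSpace

/-- A `Gδ` subset of a Polish space is Polish. -/
theorem IsGδ.polishSpace {α : Type*} [TopologicalSpace α] [PolishSpace α] {s : Set α}
    (hs : IsGδ s) : PolishSpace s := by
  obtain ⟨U, hU, rfl⟩ := isGδ_iff_eq_iInter_nat.1 hs
  have := fun n => (hU n).polishSpace
  let f : ↥(⋂ n, U n) → ∀ n, U n := fun x n => ⟨x, mem_iInter.1 x.2 n⟩
  have hf : Continuous f := continuous_pi fun n => continuous_subtype_val.subtype_mk _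
  have hemb : IsEmbedding f := .of_comp hf
    (g := fun y => (y 0 : α)) (continuous_subtype_val.comp (continuous_apply 0)) .subtypeVal
  refine IsClosedEmbedding.polishSpace (f := f) ⟨hemb, ?_⟩
  have hrange : range f = ⋂ n, {y | (y n : α) = y 0} := by
    ext y
    simp only [mem_range, mem_iInter, mem_ofPred_eq]
    constructor
    · rintro ⟨x, rfl⟩ n
      rfl
    · intro h
      refine ⟨⟨y 0, mem_iInter.2 fun n => h n ▸ (y n).2⟩, ?_⟩
      ext n
      exact (h n).symm
  rw [hrange]
  exact isClosed_iInter fun n => isClosed_eq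
    (continuous_subtype_val.comp (continuous_apply n))
    (continuous_subtype_val.comp (continuous_apply 0))

/-- In a zero-dimensional separable complete metric space, every noncompact clopen set splits into
infinitely many nonempty clopen sets of small diameter. -/
theorem IsClopen.exists_clopen_partition_ediam_le {α : Type*} [MetricSpace α] [CompleteSpace α]
    [SecondCountableTopology α] (hb : IsTopologicalBasis {s : Set α | IsClopen s})
    {U : Set α} (hU : IsClopen U) (hc : ¬ IsCompact U) {ε : ENNReal} (hε : 0 < ε) :
    ∃ V : ℕ → Set α, (∀ n, IsClopen (V n)) ∧ (∀ n, (V n).Nonempty) ∧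
      Pairwise (Function.onFun Disjoint V) ∧ ⋃ n, V n = U ∧ ∀ n, Metric.ediam (V n) ≤ ε := by
  have htb : ¬ TotallyBounded U := fun h =>
    hc (isCompact_iff_totallyBounded_isComplete.2 ⟨h, hU.isClosed.isComplete⟩)
  rw [EMetric.totallyBounded_iff] at htb
  push Not at htb
  obtain ⟨δ, hδ, hcov⟩ := htb
  set η := min δ (ε / 2)
  have hη : 0 < η := lt_min hδ (ENNReal.half_pos hε.ne')
  have hW : ∀ x ∈ U, ∃ W : Set α, IsClopen W ∧ x ∈ W ∧ W ⊆ U ∩ Metric.eball x η := fun x hx => by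
    obtain ⟨W, hW, hxW, hWU⟩ := hb.mem_nhds_iff.1
      (inter_mem (hU.isOpen.mem_nhds hx) (Metric.eball_mem_nhds x hη))
    exact ⟨W, hW, hxW, hWU⟩
  choose! W hWc hxW hWU using hW
  obtain ⟨t, htU, htc, hUt⟩ := countable_cover_nhdsWithin (s := U) (f := W)
    fun x hx => mem_nhdsWithin_of_mem_nhds ((hWc x hx).isOpen.mem_nhds (hxW x hx))
  have hUne : U.Nonempty := by
    rw [nonempty_iff_ne_empty]
    rintro rfl
    exact hc isCompact_empty
  have htne : t.Nonempty := by
    obtain ⟨x, hx⟩ := hUne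
    obtain ⟨y, hy, -⟩ := mem_iUnion₂.1 (hUt hx)
    exact ⟨y, hy⟩
  obtain ⟨f, rfl⟩ := htc.exists_eq_range htne
  have hfU : ∀ n, f n ∈ U := fun n => htU (mem_range_self n)
  set g : ℕ → Set α := disjointed fun n => W (f n)
  have hgW : ∀ n, g n ⊆ W (f n) := fun n => disjointed_subset _ n
  have hgc : ∀ n, IsClopen (g n) := fun n =>
    disjointedRec (fun _ _ h => h.diff (hWc _ (hfU _))) (hWc _ (hfU n))
  have hgU : ⋃ n, g n = U := by
    refine Subset.antisymm
      (iUnion_subset fun n => (hgW n).trans ((hWU _ (hfU n)).trans inter_subset_left)) ?_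
    rw [iUnion_disjointed]
    simpa using hUt
  have hinf : {n | (g n).Nonempty}.Infinite := by
    intro hfin
    refine hcov (f '' {n | (g n).Nonempty}) (hfin.image f) fun x hx => ?_
    rw [← hgU] at hx
    obtain ⟨n, hn⟩ := mem_iUnion.1 hx
    refine mem_iUnion₂.2 ⟨f n, mem_image_of_mem f ⟨x, hn⟩, ?_⟩
    exact Metric.eball_subset_eball (min_le_left _ _) (hWU _ (hfU n) (hgW n hn)).2
  have hinj := Nat.nth_injective hinf
  refine ⟨fun n => g (Nat.nth _ n), fun n => hgc _, fun n => Nat.nth_mem_of_infinite hinf n,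
    fun m n hmn => disjoint_disjointed _ (hinj.ne hmn), ?_, fun n => ?_⟩
  · refine Subset.antisymm (iUnion_subset fun n => hgU ▸ subset_iUnion g _) fun x hx => ?_
    rw [← hgU] at hx
    obtain ⟨n, hn⟩ := mem_iUnion.1 hx
    obtain ⟨k, hk⟩ := (Nat.range_nth_of_infinite hinf).ge
      (show n ∈ {n | (g n).Nonempty} from ⟨x, hn⟩)
    exact mem_iUnion.2 ⟨k, hk ▸ hn⟩
  · calc Metric.ediam (g (Nat.nth _ n)) ≤ Metric.ediam (Metric.eball (f (Nat.nth _ n)) η) :=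
        Metric.ediam_mono ((hgW _).trans ((hWU _ (hfU _)).trans inter_subset_right))
      _ ≤ 2 * η := Metric.ediam_eball_le
      _ ≤ 2 * (ε / 2) := by gcongr; exact min_le_right _ _
      _ = ε := ENNReal.mul_div_cancel (by simp) (by simp)

open PiNat CantorScheme in
/-- Alexandrov–Urysohn: a nonempty zero-dimensional Polish space in which no nonempty open set is
compact is homeomorphic to the Baire space. -/
theorem nonempty_homeomorph_baireSpace {α : Type*} [TopologicalSpace α] [PolishSpace α] [Nonempty α]
    (hb : IsTopologicalBasis {s : Set α | IsClopen s})
    (hc : ∀ U : Set α, IsOpen U → U.Nonempty → ¬ IsCompact U) :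
    Nonempty (α ≃ₜ (ℕ → ℕ)) := by
  let := upgradeIsCompletelyMetrizable α
  let C := {U : Set α // IsClopen U ∧ U.Nonempty}
  have hstep : ∀ (U : C) (n : ℕ), ∃ V : ℕ → C, (Pairwise fun i j => Disjoint (V i).1 (V j).1) ∧
      ⋃ k, (V k).1 = U.1 ∧ ∀ k, Metric.ediam (V k).1 ≤ (n : ENNReal)⁻¹ := fun U n => by
    obtain ⟨V, hV, hne, hd, hUV, hdiam⟩ := U.2.1.exists_clopen_partition_ediam_le hb
      (hc U.1 U.2.1.isOpen U.2.2) (ε := (n : ENNReal)⁻¹) (by simp)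
    exact ⟨fun k => ⟨V k, hV k, hne k⟩, hd, hUV, hdiam⟩
  choose V hVd hVU hVdiam using hstep
  let B : List ℕ → C := fun l =>
    List.rec ⟨univ, isClopen_univ, univ_nonempty⟩ (fun a l U => V U l.length a) l
  let A : List ℕ → Set α := fun l => (B l).1
  have hanti : CantorScheme.Antitone A := fun l a =>
    (subset_iUnion (fun k => (V (B l) l.length k).1) a).trans (hVU _ _).subset
  have hdisj : CantorScheme.Disjoint A := fun l => hVd (B l) l.length
  have hdiam : VanishingDiam A := fun x => by
    rw [← tendsto_add_atTop_iff_nat 1]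
    refine tendsto_of_tendsto_of_tendsto_of_le_of_le tendsto_const_nhds
      ENNReal.tendsto_inv_nat_nhds_zero (fun _ => zero_le) fun n => ?_
    have h : Metric.ediam (A (res x (n + 1))) ≤ ((res x n).length : ENNReal)⁻¹ :=
      hVdiam (B (res x n)) (res x n).length (x n)
    rwa [res_length] at h
  have hdom : (inducedMap A).1 = univ := ClosureAntitone.map_of_vanishingDiam hdiam
    (hanti.closureAntitone fun l => (B l).2.1.isClosed) fun l => (B l).2.2
  have hunique : ∀ (y : α) (l l' : List ℕ), l.length = l'.length → y ∈ A l → y ∈ A l' → l = l' := by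
    intro y l
    induction l with
    | nil => intro l' h _ _; exact (List.length_eq_zero_iff.1 h.symm).symm
    | cons a l ih =>
      rintro (_ | ⟨a', l'⟩) h hy hy'
      · simp at h
      · obtain rfl := ih l' (by simpa using h) (hanti _ _ hy) (hanti _ _ hy')
        by_contra hne
        exact disjoint_left.1 (hdisj l (fun haa' : a = a' => hne (by rw [haa']))) hy hy'
  let F : (ℕ → ℕ) → α := fun x => (inducedMap A).2 ⟨x, hdom ▸ mem_univ x⟩
  have hFmem : ∀ x n, F x ∈ A (res x n) := fun x n => map_mem _ n
  have hFcont : Continuous F := hdiam.map_continuous.comp (continuous_id.subtype_mk _)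
  have hFinj : Function.Injective F := fun x y hxy =>
    congrArg Subtype.val (hdisj.map_injective hxy)
  have hFsurj : Function.Surjective F := fun y => by
    have hnext : ∀ l, y ∈ A l → ∃ a, y ∈ A (a :: l) := fun l hl =>
      mem_iUnion.1 ((hVU (B l) l.length).superset hl)
    choose! next hnext using hnext
    let L : ℕ → List ℕ := fun n => Nat.rec [] (fun _ l => next l :: l) n
    have hL : ∀ n, y ∈ A (L n) := fun n => by
      induction n with
      | zero => exact mem_univ y
      | succ n ih => exact hnext _ ih
    have hres : ∀ n, res (fun k => next (L k)) n = L n := fun n => by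
      induction n with
      | zero => rfl
      | succ n ih => rw [res_succ, ih]
    refine ⟨fun k => next (L k), eq_of_forall_dist_le fun ε hε => ?_⟩
    obtain ⟨n, hn⟩ := hdiam.dist_lt ε hε fun k => next (L k)
    exact (hn _ (hFmem _ n) _ (hres n ▸ hL n)).le
  let e : (ℕ → ℕ) ≃ α := Equiv.ofBijective F ⟨hFinj, hFsurj⟩
  have hmem : ∀ y n, y ∈ A (res (e.symm y) n) := fun y n => by
    have h := hFmem (e.symm y) n
    rwa [show F (e.symm y) = y from e.apply_symm_apply y] at h
  refine ⟨⟨e.symm, continuous_pi fun n => ?_, hFcont⟩⟩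
  refine IsLocallyConstant.continuous (IsLocallyConstant.iff_eventually_eq _ |>.2 fun y => ?_)
  filter_upwards [(B (res (e.symm y) (n + 1))).2.1.isOpen.mem_nhds (hmem y (n + 1))] with z hz
  have := hunique z _ _ ((res_length _ _).trans (res_length _ (n + 1)).symm) (hmem z (n + 1)) hz
  rw [res_succ, res_succ] at this
  exact (List.cons.inj this).1

/-- A nonempty `Gδ` subset of a Polish ultrametric space in which every point is approximated by
infinite uniformly separated sequences is homeomorphic to the Baire space. -/
theorem IsGδ.nonempty_homeomorph_baireSpace {E : Type*} [MetricSpace E] [IsUltrametricDist E]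
    [PolishSpace E] {S : Set E} (hS : IsGδ S) (hne : S.Nonempty)
    (hsep : ∀ x ∈ S, ∀ ε > 0, ∃ δ > 0, ∃ y : ℕ → E, (∀ n, y n ∈ S ∧ dist (y n) x < ε) ∧
      Pairwise fun m n => δ ≤ dist (y m) (y n)) :
    Nonempty (S ≃ₜ (ℕ → ℕ)) := by
  have := hS.polishSpace
  have := hne.to_subtype
  refine _root_.nonempty_homeomorph_baireSpace
    (isTopologicalBasis_of_isOpen_of_nhds (fun _ h => h.isOpen) fun x U hx hU => ?_) ?_
  · obtain ⟨r, hr, hrU⟩ := Metric.isOpen_iff.1 hU x hx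
    exact ⟨_, IsUltrametricDist.isClopen_ball x r, Metric.mem_ball_self hr, hrU⟩
  · rintro U hU ⟨x, hx⟩ hUc
    obtain ⟨r, hr, hrU⟩ := Metric.isOpen_iff.1 hU x hx
    obtain ⟨δ, hδ, y, hy, hyδ⟩ := hsep x x.2 r hr
    obtain ⟨z, -, φ, hφ, hlim⟩ := hUc.isSeqCompact
      (x := fun n => (⟨y n, (hy n).1⟩ : S)) fun n => hrU (hy n).2
    obtain ⟨N, hN⟩ := Metric.cauchySeq_iff.1 hlim.cauchySeq δ hδ
    exact (hyδ (hφ.injective.ne N.lt_succ_self.ne)).not_gt (hN N le_rfl (N + 1) N.le_succ)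

/-- The element of `c₀` given by a sequence tending to zero. -/
def ZeroAtInftyContinuousMap.ofTendsto {R : Type*} [TopologicalSpace R] [Zero R] (f : ℕ → R)
    (hf : Tendsto f atTop (𝓝 0)) : C₀(ℕ, R) where
  toFun := f
  continuous_toFun := continuous_of_discreteTopology
  zero_at_infty' := by rwa [cocompact_eq_cofinite, Nat.cofinite_eq_atTop]

/-- The element of `c₀` whose only nonzero coordinate is `a`, at position `n`. -/
def ZeroAtInftyContinuousMap.single {R : Type*} [TopologicalSpace R] [Zero R] (n : ℕ) (a : R) :
    C₀(ℕ, R) :=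
  .ofTendsto (Pi.single n a) <| tendsto_const_nhds.congr' <| by
    filter_upwards [eventually_gt_atTop n] with m hm
    simp [hm.ne']

open ZeroAtInftyContinuousMap

@[simp]
theorem ZeroAtInftyContinuousMap.ofTendsto_apply {R : Type*} [TopologicalSpace R] [Zero R]
    (f : ℕ → R) (hf : Tendsto f atTop (𝓝 0)) (n : ℕ) : ofTendsto f hf n = f n :=
  rfl

@[simp]
theorem ZeroAtInftyContinuousMap.single_apply {R : Type*} [TopologicalSpace R] [Zero R]
    (n : ℕ) (a : R) (m : ℕ) : single n a m = if m = n then a else 0 :=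
  Pi.single_apply n a m

theorem ZeroAtInftyContinuousMap.tendsto_atTop {R : Type*} [TopologicalSpace R] [Zero R]
    (f : C₀(ℕ, R)) : Tendsto f atTop (𝓝 0) := by
  simpa only [cocompact_eq_cofinite, Nat.cofinite_eq_atTop] using zero_at_infty f

theorem ZeroAtInftyContinuousMap.norm_apply_le {α E : Type*} [TopologicalSpace α]
    [NormedAddCommGroup E] (f : C₀(α, E)) (x : α) : ‖f x‖ ≤ ‖f‖ :=
  f.toBCF.norm_coe_le_norm x

theorem ZeroAtInftyContinuousMap.norm_le {α E : Type*} [TopologicalSpace α]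
    [NormedAddCommGroup E] {f : C₀(α, E)} {C : ℝ} (hC : 0 ≤ C) : ‖f‖ ≤ C ↔ ∀ x, ‖f x‖ ≤ C :=
  BoundedContinuousFunction.norm_le (f := f.toBCF) hC

instance ZeroAtInftyContinuousMap.isUltrametricDist {α E : Type*} [TopologicalSpace α]
    [NormedAddCommGroup E] [IsUltrametricDist E] : IsUltrametricDist C₀(α, E) := by
  refine IsUltrametricDist.isUltrametricDist_of_forall_norm_add_le_max_norm fun f g => ?_
  refine (norm_le (by positivity)).2 fun x => ?_
  exact (IsUltrametricDist.norm_add_le_max (f x) (g x)).trans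
    (max_le_max (norm_apply_le f x) (norm_apply_le g x))

theorem ZeroAtInftyContinuousMap.continuous_apply_const {α E : Type*} [TopologicalSpace α]
    [NormedAddCommGroup E] (x : α) : Continuous fun f : C₀(α, E) => f x :=
  (BoundedContinuousFunction.lipschitz_eval_const x).continuous.comp
    (isometry_toBCF (α := α) (β := E)).continuous

theorem ZeroAtInftyContinuousMap.finset_sum_apply {α E ι : Type*} [TopologicalSpace α]
    [NormedAddCommGroup E] (s : Finset ι) (f : ι → C₀(α, E)) (x : α) :
    (∑ i ∈ s, f i) x = ∑ i ∈ s, f i x :=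
  map_sum (⟨⟨fun g => g x, rfl⟩, fun _ _ => rfl⟩ : C₀(α, E) →+ E) f s

theorem ZeroAtInftyContinuousMap.norm_single_le {E : Type*} [NormedAddCommGroup E] (n : ℕ) (a : E) :
    ‖single n a‖ ≤ ‖a‖ :=
  (norm_le (norm_nonneg a)).2 fun k => by
    rw [single_apply]
    split_ifs <;> simp

/-- The space `c₀` over a separable normed field is separable. -/
instance ZeroAtInftyContinuousMap.separableSpace_nat {𝕜 : Type*} [NormedField 𝕜]
    [SeparableSpace 𝕜] : SeparableSpace C₀(ℕ, 𝕜) := by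
  have hsep := ((countable_range fun n => single n (1 : 𝕜)).isSeparable.span (R := 𝕜)).closure
  rw [← isSeparable_univ_iff]
  refine hsep.mono fun x _ => Metric.mem_closure_iff.2 fun ε hε => ?_
  obtain ⟨N, hN⟩ := Metric.tendsto_atTop.1 x.tendsto_atTop (ε / 2) (by positivity)
  refine ⟨∑ i ∈ Finset.range N, x i • single i (1 : 𝕜), Submodule.sum_mem _ fun i _ =>
    Submodule.smul_mem _ _ (Submodule.subset_span (mem_range_self i)), ?_⟩
  rw [dist_eq_norm]
  refine lt_of_le_of_lt ((norm_le (by positivity)).2 fun k => ?_) (half_lt_self hε)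
  rw [sub_apply, finset_sum_apply]
  by_cases hk : k < N
  · simp [hk, (half_pos hε).le]
  · simpa [hk] using (hN k (not_lt.1 hk)).le

theorem IsUltrametricDist.norm_sub_le_max {E : Type*} [SeminormedAddCommGroup E]
    [IsUltrametricDist E] (x y : E) : ‖x - y‖ ≤ max ‖x‖ ‖y‖ := by
  simpa [sub_eq_add_neg] using IsUltrametricDist.norm_add_le_max x (-y)

theorem polishSpace_c₀ (𝕜 : Type*) [NontriviallyNormedField 𝕜] [CompleteSpace 𝕜]
    [LocallyCompactSpace 𝕜] : PolishSpace C₀(ℕ, 𝕜) := by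
  have : ProperSpace 𝕜 := .of_locallyCompactSpace 𝕜
  have : SecondCountableTopology 𝕜 := secondCountable_of_proper
  infer_instance

theorem mem_evZero_iff (𝕜 : Type*) [NontriviallyNormedField 𝕜]
    {x : C₀(ℕ, 𝕜)} : x ∈ evZero 𝕜 ↔ ∃ n, ∀ k, n ≤ k → x k = 0 := by
  simp [evZero]

theorem isGδ_compl_evZero (𝕜 : Type*) [NontriviallyNormedField 𝕜] : IsGδ (evZero 𝕜)ᶜ := by
  rw [evZero, compl_iUnion]
  refine .iInter_of_isOpen fun n => isOpen_compl_iff.2 ?_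
  have h : {x : C₀(ℕ, 𝕜) | ∀ k, n ≤ k → x k = 0} = ⋂ k, ⋂ (_ : n ≤ k), {x | x k = 0} := by
    ext
    simp
  rw [h]
  exact isClosed_iInter fun k => isClosed_iInter fun _ =>
    isClosed_eq (continuous_apply_const k) continuous_const

theorem nonempty_homeomorph_compl_evZero : Nonempty (↥(evZero K)ᶜ ≃ₜ (ℕ → ℕ)) := by
  have := polishSpace_c₀ K
  refine (isGδ_compl_evZero K).nonempty_homeomorph_baireSpace ?_ fun x hx ε hε => ?_
  · obtain ⟨c, hc0, hc1⟩ := NormedField.exists_norm_lt_one K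
    refine ⟨.ofTendsto (fun n => c ^ n) (tendsto_pow_atTop_nhds_zero_of_norm_lt_one hc1), ?_⟩
    rw [mem_compl_iff, mem_evZero_iff]
    rintro ⟨n, hn⟩
    exact pow_ne_zero n (norm_pos_iff.1 hc0) (hn n le_rfl)
  · obtain ⟨a, ha0, haε⟩ := NormedField.exists_norm_lt K hε
    refine ⟨‖a‖, ha0, fun n => x + single n a, fun n => ⟨?_, ?_⟩, fun m n hmn => ?_⟩
    · rw [mem_compl_iff, mem_evZero_iff] at hx ⊢
      rintro ⟨N, hN⟩
      refine hx ⟨max N (n + 1), fun k hk => ?_⟩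
      have := hN k (le_of_max_le_left hk)
      rwa [ZeroAtInftyContinuousMap.add_apply, single_apply,
        if_neg (by have := le_of_max_le_right hk; omega), add_zero] at this
    · rw [dist_eq_norm, add_sub_cancel_left]
      exact (norm_single_le n a).trans_lt haε
    · change ‖a‖ ≤ dist (x + single m a) (x + single n a)
      rw [dist_eq_norm, add_sub_add_left_eq_sub]
      simpa [hmn] using norm_apply_le (single m a - single n a) m

theorem norm_pSum_le (𝕜 : Type*) [NontriviallyNormedField 𝕜] [IsUltrametricDist 𝕜]
    (x : C₀(ℕ, 𝕜)) (m : ℕ) : ‖pSum 𝕜 x m‖ ≤ ‖x‖ :=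
  IsUltrametricDist.norm_sum_le_of_forall_le_of_nonneg (norm_nonneg x) fun i _ => norm_apply_le x i

theorem pSum_add (𝕜 : Type*) [NontriviallyNormedField 𝕜]
    (x y : C₀(ℕ, 𝕜)) (m : ℕ) : pSum 𝕜 ⇑(x + y) m = pSum 𝕜 x m + pSum 𝕜 y m :=
  Finset.sum_add_distrib

theorem pSum_sub (𝕜 : Type*) [NontriviallyNormedField 𝕜] [IsUltrametricDist 𝕜]
    (x y : C₀(ℕ, 𝕜)) (m : ℕ) : pSum 𝕜 ⇑(x - y) m = pSum 𝕜 x m - pSum 𝕜 y m :=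
  Finset.sum_sub_distrib _ _

theorem pSum_single (𝕜 : Type*) [NontriviallyNormedField 𝕜]
    (n : ℕ) (a : 𝕜) (m : ℕ) : pSum 𝕜 (single n a) m = if n < m then a else 0 := by
  simp [pSum]

/-- Sequences in `A₂` are those with sum `1` whose partial sums lie in the closed unit ball and
differ from `1`. -/
theorem mem_A2_iff (𝕜 : Type*) [NontriviallyNormedField 𝕜] [IsUltrametricDist 𝕜]
    {x : C₀(ℕ, 𝕜)} : x ∈ A2 𝕜 ↔ (∀ m, ‖pSum 𝕜 x m‖ ≤ 1) ∧ (∀ m, pSum 𝕜 x m ≠ 1) ∧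
    Tendsto (fun m => pSum 𝕜 x m) atTop (𝓝 1) := by
  have hbdd : BddAbove (range fun m => ‖pSum 𝕜 x (m + 1)‖) :=
    ⟨‖x‖, forall_mem_range.2 fun m => norm_pSum_le 𝕜 x _⟩
  have h0 : pSum 𝕜 x 0 = 0 := Finset.sum_range_zero _
  constructor
  · rintro ⟨hsup, hne, hlim⟩
    refine ⟨?_, ?_, hlim⟩
    · rintro (_ | m)
      · simp [h0]
      · exact hsup ▸ le_ciSup hbdd m
    · rintro (_ | m)
      · simp [h0]
      · exact hne m
  · rintro ⟨hle, hne, hlim⟩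
    refine ⟨le_antisymm (ciSup_le fun m => hle _) ?_, fun m => hne _, hlim⟩
    have hnorm := ((tendsto_add_atTop_iff_nat 1).2 hlim).norm
    rw [norm_one] at hnorm
    exact le_of_tendsto' hnorm fun m => le_ciSup hbdd m

theorem A2star_eq_A2 (𝕜 : Type*) [NontriviallyNormedField 𝕜] [IsUltrametricDist 𝕜] :
    A2star 𝕜 = A2 𝕜 := by
  refine sdiff_eq_left.2 (disjoint_left.2 fun x hx hx0 => ?_)
  obtain ⟨n, hn⟩ := (mem_evZero_iff 𝕜).1 hx0
  obtain ⟨-, hne, hlim⟩ := (mem_A2_iff 𝕜).1 hx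
  refine hne n (tendsto_nhds_unique (tendsto_const_nhds.congr' ?_) hlim)
  filter_upwards [eventually_ge_atTop n] with m hm
  exact Finset.sum_subset (Finset.range_mono hm) fun k _ hk => hn k (by simpa using hk)

theorem isGδ_A2 (𝕜 : Type*) [NontriviallyNormedField 𝕜] [IsUltrametricDist 𝕜] : IsGδ (A2 𝕜) := by
  have hcont : ∀ m, Continuous fun x : C₀(ℕ, 𝕜) => pSum 𝕜 x m := fun m =>
    continuous_finsetSum _ fun k _ =>
      continuous_apply_const k
  have hA2 : A2 𝕜 = (⋂ m, {x : C₀(ℕ, 𝕜) | ‖pSum 𝕜 x m‖ ≤ 1}) ∩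
      (⋂ m, {x : C₀(ℕ, 𝕜) | pSum 𝕜 x m ≠ 1}) ∩
      ⋂ r : ℕ, {x : C₀(ℕ, 𝕜) | ∃ M, ∀ m ≥ M, ‖pSum 𝕜 x m - 1‖ < 1 / ((r : ℝ) + 1)} := by
    ext x
    rw [mem_A2_iff, ← and_assoc]
    simp only [mem_inter_iff, mem_iInter, mem_ofPred_eq]
    refine and_congr_right fun _ => ?_
    rw [(Metric.nhds_basis_ball_inv_nat_succ (x := (1 : 𝕜))).tendsto_right_iff]
    simp [eventually_atTop, dist_eq_norm]
  rw [hA2]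
  refine .inter (.inter (IsClosed.isGδ ?_) (.iInter_of_isOpen fun m => ?_))
    (.iInter_of_isOpen fun r => ?_)
  · exact isClosed_iInter fun m => isClosed_le (hcont m).norm continuous_const
  · exact isOpen_ne_fun (hcont m) continuous_const
  · refine Metric.isOpen_iff.2 fun x ⟨M, hM⟩ => ⟨_, Nat.one_div_pos_of_nat (n := r),
      fun y hy => ⟨M, fun m hm => ?_⟩⟩
    have hyx : ‖pSum 𝕜 y m - pSum 𝕜 x m‖ < 1 / ((r : ℝ) + 1) := by
      rw [← pSum_sub]
      exact (norm_pSum_le 𝕜 _ m).trans_lt (dist_eq_norm y x ▸ hy)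
    rw [← sub_add_sub_cancel _ (pSum 𝕜 x m)]
    exact (IsUltrametricDist.norm_add_le_max _ _).trans_lt (max_lt hyx (hM m hm))

theorem A2_nonempty (𝕜 : Type*) [NontriviallyNormedField 𝕜] [IsUltrametricDist 𝕜] :
    (A2 𝕜).Nonempty := by
  obtain ⟨c, hc0, hc1⟩ := NormedField.exists_norm_lt_one 𝕜
  have hc := tendsto_pow_atTop_nhds_zero_of_norm_lt_one hc1
  have hsum : ∀ m, pSum 𝕜 (fun n => c ^ n - c ^ (n + 1)) m = 1 - c ^ m := fun m => by
    rw [pSum, Finset.sum_range_sub', pow_zero]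
  refine ⟨.ofTendsto (fun n => c ^ n - c ^ (n + 1))
    (by simpa using hc.sub ((tendsto_add_atTop_iff_nat 1).2 hc)), (mem_A2_iff 𝕜).2 ⟨?_, ?_, ?_⟩⟩
  · intro m
    change ‖pSum 𝕜 (fun n => c ^ n - c ^ (n + 1)) m‖ ≤ 1
    rw [hsum]
    refine (IsUltrametricDist.norm_sub_le_max _ _).trans (max_le norm_one.le ?_)
    rw [norm_pow]
    exact pow_le_one₀ (norm_nonneg c) hc1.le
  · intro m
    change pSum 𝕜 (fun n => c ^ n - c ^ (n + 1)) m ≠ 1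
    rw [hsum, Ne, sub_eq_self]
    exact pow_ne_zero m (norm_pos_iff.1 hc0)
  · change Tendsto (fun m => pSum 𝕜 (fun n => c ^ n - c ^ (n + 1)) m) atTop (𝓝 1)
    simp only [hsum]
    simpa using hc.const_sub 1

theorem nonempty_homeomorph_A2star : Nonempty (A2star K ≃ₜ (ℕ → ℕ)) := by
  have := polishSpace_c₀ K
  rw [A2star_eq_A2]
  refine (isGδ_A2 K).nonempty_homeomorph_baireSpace (A2_nonempty K) fun x hx ε hε => ?_
  obtain ⟨hle, hne, hlim⟩ := (mem_A2_iff K).1 hx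
  obtain ⟨a, ha0, haε⟩ := NormedField.exists_norm_lt K (lt_min hε one_pos)
  obtain ⟨N, hN⟩ := Metric.tendsto_atTop.1 hlim ‖a‖ ha0
  let d : ℕ → C₀(ℕ, K) := fun n => single (N + n) a - single (N + n + 1) a
  have hsum : ∀ n m, pSum K ⇑(x + d n) m = pSum K x m + if m = N + n + 1 then a else 0 :=
    fun n m => by
      rw [pSum_add, pSum_sub, pSum_single, pSum_single]
      congr 1
      split_ifs <;> first | omega | simp
  refine ⟨‖a‖, ha0, fun n => x + d n, fun n => ⟨(mem_A2_iff K).2 ⟨fun m => ?_, fun m => ?_, ?_⟩, ?_⟩,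
    fun m n hmn => ?_⟩
  · rw [hsum]
    refine (IsUltrametricDist.norm_add_le_max _ _).trans (max_le (hle m) ?_)
    split_ifs
    · exact (haε.trans_le (min_le_right _ _)).le
    · simp
  · rw [hsum]
    split_ifs with hm
    · intro h
      have := hN m (by omega)
      rw [dist_eq_norm, ← h, sub_add_cancel_left, norm_neg] at this
      exact this.false
    · rw [add_zero]
      exact hne m
  · refine hlim.congr' ?_
    filter_upwards [eventually_gt_atTop (N + n + 1)] with m hm
    rw [hsum, if_neg hm.ne', add_zero]
  · rw [dist_eq_norm, add_sub_cancel_left]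
    refine (IsUltrametricDist.norm_sub_le_max _ _).trans_lt ?_
    exact (max_le (norm_single_le _ a) (norm_single_le _ a)).trans_lt
      (haε.trans_le (min_le_left _ _))
  · change ‖a‖ ≤ dist (x + d m) (x + d n)
    rw [dist_eq_norm]
    have hpm := norm_pSum_le K ((x + d m) - (x + d n)) (N + m + 1)
    rwa [pSum_sub, hsum, hsum, if_pos rfl, if_neg (by omega), add_zero, add_sub_cancel_left] at hpm

/-- Let `K` be a locally compact field with a complete
non-Archimedean multiplicative norm whose value group is nontrivial.  The space
`c₀ \ ⋃_{n=1}^∞ Eⁿ`, with the subspace topology, is homeomorphic to `A₂*`. -/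
theorem c0_sdiff_evZero_homeomorph_A2star :
    Nonempty (↥((evZero K)ᶜ) ≃ₜ ↥(A2star K)) := by
  obtain ⟨e⟩ := nonempty_homeomorph_compl_evZero K
  obtain ⟨f⟩ := nonempty_homeomorph_A2star K
  exact ⟨e.trans f.symm⟩

end
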